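/- Let M ≥ 1, β > 0, and let f(·; m) : ℝ^d → ℝ for m = 1,…,M be convex and β-smooth, with average F(w) = (1/M)Σ_{m=1}^M f(w; m). Let surrogates \tilde f^{(t)}(·; m) : ℝ^d → ℝ for t = 1,…,k, m = 1,…,M be convex and β-smooth. Assume joint realizability: there exists w⋆ ∈ ℝ^d such that f(w⋆; m) = 0 = min_w f(w; m) and \tilde f^{(t)}(w⋆; m) = 0 = min_w \tilde f^{(t)}(w; m) for all t, m. Assume for all t, m, w: \tilde f^{(t)}(w; m) ≤ f(w; m) ≤ (1 + η_t β)·\tilde f^{(t)}(w; m), where the step sizes η_1 ≥ η_2 ≥ ⋯ ≥ η_k > 0 are non-increasing and satisfy η_t ≤ η with ηβ ≤ 1/4. Let τ_1,…,τ_k be i.i.d. uniform on {1,…,M}, fix w_0 ∈ ℝ^d, and set w_t = w_{t−1} − η_t ∇\tilde f^{(t)}(w_{t−1}; τ_t) for t = 1,…,k. Then the expected seen-task loss of the final iterate is stable: E[(1/k)Σ_{t=1}^k f(w_k; τ_t)] ≤ 2·E F(w_k) + 8β²η‖w_0 − w⋆‖²/k. -/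

import Mathlib

section aux
variable {E : Type*} [NormedAddCommGroup E] [InnerProductSpace ℝ E] [CompleteSpace E]

lemma aux_line (f : E → ℝ) (g : E → E) (hg : ∀ x, HasGradientAt f (g x) x) (x v : E) (s : ℝ) :
    HasDerivAt (fun s : ℝ => f (x + s • v)) (inner ℝ (g (x + s • v)) v) s := by
  have h1 : HasDerivAt (fun s : ℝ => x + s • v) v s := by
    simpa using ((hasDerivAt_id s).smul_const v).const_add x
  have h2 := (hg (x + s • v)).hasFDerivAt.comp_hasDerivAt s h1
  refine HasDerivAt.congr_deriv (f := fun s : ℝ => f (x + s • v)) h2 ?_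
  simp

lemma aux_descent (f : E → ℝ) (g : E → E) (hg : ∀ x, HasGradientAt f (g x) x) (β : ℝ)
    (hs : ∀ u v, ‖g u - g v‖ ≤ β * ‖u - v‖) (x v : E) :
    f (x + v) ≤ f x + inner ℝ (g x) v + β / 2 * ‖v‖ ^ 2 := by
  let φ : ℝ → ℝ := fun s => f (x + s • v) - s * inner ℝ (g x) v - β / 2 * s ^ 2 * ‖v‖ ^ 2
  have hd : ∀ s, HasDerivAt φ (inner ℝ (g (x + s • v)) v - inner ℝ (g x) v - β * s * ‖v‖ ^ 2) s := by
    intro s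
    have h2 := ((aux_line f g hg x v s).sub ((hasDerivAt_id s).mul_const (inner ℝ (g x) v))).sub
      ((((hasDerivAt_id s).pow 2).const_mul (β / 2)).mul_const (‖v‖ ^ 2))
    refine h2.congr_deriv ?_
    simp only [id, Nat.cast_ofNat, Nat.add_one_sub_one, pow_one]
    ring
  have ha : AntitoneOn φ (Set.Icc 0 1) := by
    refine antitoneOn_of_deriv_nonpos (convex_Icc 0 1)
      (fun s _ => (hd s).continuousAt.continuousWithinAt)
      (fun s _ => (hd s).differentiableAt.differentiableWithinAt) ?_
    intro s hs'
    rw [interior_Icc] at hs'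
    rw [(hd s).deriv, ← inner_sub_left]
    have h1 := real_inner_le_norm (g (x + s • v) - g x) v
    have h2 := hs (x + s • v) x
    rw [add_sub_cancel_left, norm_smul, Real.norm_of_nonneg hs'.1.le] at h2
    nlinarith [mul_le_mul_of_nonneg_right h2 (norm_nonneg v)]
  have := ha (by simp : (0:ℝ) ∈ Set.Icc (0:ℝ) 1) (by simp : (1:ℝ) ∈ Set.Icc (0:ℝ) 1) zero_le_one
  simp [φ] at this
  linarith

lemma aux_convex (f : E → ℝ) (g : E → E) (hg : ∀ x, HasGradientAt f (g x) x)
    (hc : ConvexOn ℝ Set.univ f) (x v : E) :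
    f x + inner ℝ (g x) v ≤ f (x + v) := by
  have h1 : ConvexOn ℝ Set.univ (fun s : ℝ => f (x + s • v)) := by
    refine ⟨convex_univ, fun a _ b _ p q hp hq hpq => ?_⟩
    have := hc.2 (Set.mem_univ (x + a • v)) (Set.mem_univ (x + b • v)) hp hq hpq
    refine le_trans (le_of_eq ?_) this
    obtain rfl : q = 1 - p := by linarith
    simp only [smul_eq_mul]
    congr 1
    module
  have h2 := h1.le_slope_of_hasDerivAt (Set.mem_univ (0:ℝ)) (Set.mem_univ (1:ℝ)) zero_lt_one
    (aux_line f g hg x v 0)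
  simp [slope] at h2
  linarith

lemma aux_selfbound (f : E → ℝ) (g : E → E) (hg : ∀ x, HasGradientAt f (g x) x) (β : ℝ) (hβ : 0 < β)
    (hs : ∀ u v, ‖g u - g v‖ ≤ β * ‖u - v‖) (c : ℝ) (hc : ∀ x, c ≤ f x) (x : E) :
    ‖g x‖ ^ 2 ≤ 2 * β * (f x - c) := by
  have h := aux_descent f g hg β hs x (-(1/β) • g x)
  have h2 := hc (x + -(1/β) • g x)
  rw [inner_smul_right, real_inner_self_eq_norm_sq, norm_smul, mul_pow] at h
  have e : β / 2 * (‖-(1/β)‖ ^ 2 * ‖g x‖ ^ 2) = 1 / (2 * β) * ‖g x‖ ^ 2 := by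
    rw [Real.norm_eq_abs, sq_abs]; field_simp
  have e2 : -(1/β) * ‖g x‖ ^ 2 = - (2 * (1 / (2 * β) * ‖g x‖ ^ 2)) := by field_simp
  rw [e, e2] at h
  have h3 : 1 / (2 * β) * ‖g x‖ ^ 2 ≤ f x - c := by linarith
  rw [div_mul_eq_mul_div, one_mul, div_le_iff₀ (by positivity)] at h3
  linarith

lemma aux_coco (f : E → ℝ) (g : E → E) (hg : ∀ x, HasGradientAt f (g x) x) (β : ℝ) (hβ : 0 < β)
    (hs : ∀ u v, ‖g u - g v‖ ≤ β * ‖u - v‖) (hc : ConvexOn ℝ Set.univ f) (u v : E) :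
    ‖g u - g v‖ ^ 2 ≤ β * inner ℝ (g u - g v) (u - v) := by
  have key : ∀ a b : E, ‖g b - g a‖ ^ 2 ≤ 2 * β * (f b - f a - inner ℝ (g a) (b - a)) := by
    intro a b
    have h := aux_selfbound (fun z => f z - inner ℝ (g a) z) (fun z => g z - g a) ?_ β hβ
      (by intro p q; simpa using hs p q) (f a - inner ℝ (g a) a) ?_ b
    · refine h.trans (le_of_eq ?_)
      rw [inner_sub_right]; ring
    · intro z
      have h1 : HasGradientAt (fun z => inner ℝ (g a) z) (g a) z := by
        rw [hasGradientAt_iff_hasFDerivAt]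
        exact ((InnerProductSpace.toDual ℝ E) (g a)).hasFDerivAt
      rw [hasGradientAt_iff_hasFDerivAt] at h1 ⊢
      rw [map_sub]
      exact (hg z).hasFDerivAt.sub h1
    · intro z
      have := aux_convex f g hg hc a (z - a)
      rw [inner_sub_right] at this
      simp at this ⊢
      linarith
  have h1 := key u v
  have h2 := key v u
  rw [norm_sub_rev] at h1
  have e : inner ℝ (g u - g v) (u - v) = - inner ℝ (g u) (v - u) - inner ℝ (g v) (u - v) := by
    simp only [inner_sub_left, inner_sub_right]; ring
  rw [e]
  nlinarith

lemma aux_nonexp (f : E → ℝ) (g : E → E) (hg : ∀ x, HasGradientAt f (g x) x) (β : ℝ) (hβ : 0 < β)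
    (hs : ∀ u v, ‖g u - g v‖ ≤ β * ‖u - v‖) (hc : ConvexOn ℝ Set.univ f) (η : ℝ) (h0 : 0 < η)
    (h1 : η * β ≤ 1 / 4) (u v : E) :
    ‖(u - η • g u) - (v - η • g v)‖ ^ 2 ≤ ‖u - v‖ ^ 2 := by
  have h := aux_coco f g hg β hβ hs hc u v
  have e : (u - η • g u) - (v - η • g v) = (u - v) - η • (g u - g v) := by module
  rw [e, norm_sub_sq_real, inner_smul_right, norm_smul, mul_pow, Real.norm_of_nonneg h0.le,
    real_inner_comm]
  set I := inner ℝ (g u - g v) (u - v)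
  have hI : 0 ≤ I := by
    have := (sq_nonneg ‖g u - g v‖).trans h
    exact nonneg_of_mul_nonneg_right this hβ
  have h3 := mul_le_mul_of_nonneg_left h (sq_nonneg η)
  have h4 := mul_le_mul_of_nonneg_right h1 (mul_nonneg h0.le hI)
  nlinarith [mul_nonneg h0.le hI]

lemma aux_regret (f : E → ℝ) (g : E → E) (hg : ∀ x, HasGradientAt f (g x) x) (β : ℝ) (hβ : 0 < β)
    (hs : ∀ u v, ‖g u - g v‖ ≤ β * ‖u - v‖) (hc : ConvexOn ℝ Set.univ f) (η : ℝ) (h0 : 0 < η)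
    (h1 : η * β ≤ 1 / 4) (z : E) (hz : f z = 0) (hmin : ∀ x, 0 ≤ f x) (u : E) :
    η * f u ≤ ‖u - z‖ ^ 2 - ‖u - η • g u - z‖ ^ 2 := by
  have h := aux_selfbound f g hg β hβ hs 0 hmin u
  have h2 := aux_convex f g hg hc u (z - u)
  have e : u - η • g u - z = (u - z) - η • g u := by module
  rw [e, norm_sub_sq_real (u - z), inner_smul_right, norm_smul, mul_pow, Real.norm_of_nonneg h0.le,
    real_inner_comm]
  rw [add_sub_cancel, hz, ← neg_sub u z, inner_neg_right] at h2
  set I := inner ℝ (g u) (u - z)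
  have h3 := mul_le_mul_of_nonneg_left h (sq_nonneg η)
  have h4 := mul_le_mul_of_nonneg_right h1 (mul_nonneg h0.le (hmin u))
  have h5 := mul_le_mul_of_nonneg_left h2 h0.le
  nlinarith [mul_nonneg h0.le (hmin u)]

lemma aux_compare (f : E → ℝ) (g : E → E) (hg : ∀ x, HasGradientAt f (g x) x) (β : ℝ) (hβ : 0 < β)
    (hs : ∀ u v, ‖g u - g v‖ ≤ β * ‖u - v‖) (hmin : ∀ x, 0 ≤ f x) (u v : E) :
    f u ≤ 2 * f v + β * ‖u - v‖ ^ 2 := by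
  have h := aux_selfbound f g hg β hβ hs 0 hmin v
  have h2 := aux_descent f g hg β hs v (u - v)
  rw [add_sub_cancel] at h2
  have h3 := real_inner_le_norm (g v) (u - v)
  have h4 : ‖g v‖ * ‖u - v‖ ≤ f v + β / 2 * ‖u - v‖ ^ 2 := by
    have : 0 ≤ (‖g v‖ - β * ‖u - v‖) ^ 2 := sq_nonneg _
    have : 2 * β * (‖g v‖ * ‖u - v‖) ≤ 2 * β * (f v + β / 2 * ‖u - v‖ ^ 2) := by nlinarith
    exact le_of_mul_le_mul_left this (by positivity)
  linarith
end aux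

lemma aux_swap {k M : ℕ} (t : Fin k) (G : (Fin k → Fin M) → (Fin k → Fin M) → ℝ) :
    ∑ τ : Fin k → Fin M, ∑ m : Fin M, G τ (Function.update τ t m)
      = ∑ τ : Fin k → Fin M, ∑ m : Fin M, G (Function.update τ t m) τ := by
  rw [← Fintype.sum_prod_type', ← Fintype.sum_prod_type']
  let i : (Fin k → Fin M) × Fin M → (Fin k → Fin M) × Fin M :=
    fun p => (Function.update p.1 t p.2, p.1 t)
  have hi : Function.Involutive i := by
    intro p; simp [i]
  refine Fintype.sum_equiv hi.toPerm _ _ ?_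
  intro p
  simp [i]


/-- stability of the seen-task loss for SGD on time-varying surrogates
with non-increasing step sizes `η_t ≤ ηmax`, `ηmax·β ≤ 1/4`:
`E[(1/k)Σ_t f(w_k; τ_t)] ≤ 2·E F(w_k) + 8β²ηmax‖w₀−w⋆‖²/k`. -/
theorem sgd_seen_task_stability {d M : ℕ} (hM : 1 ≤ M)
    (β : ℝ) (hβ : 0 < β)
    (f : Fin M → EuclideanSpace ℝ (Fin d) → ℝ)
    (hfdiff : ∀ m, Differentiable ℝ (f m))
    (hfconv : ∀ m, ConvexOn ℝ Set.univ (f m))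
    (hfsmooth : ∀ (m : Fin M) (u v : EuclideanSpace ℝ (Fin d)),
      ‖gradient (f m) u - gradient (f m) v‖ ≤ β * ‖u - v‖)
    (k : ℕ) (hk : 1 ≤ k)
    (tf : Fin k → Fin M → EuclideanSpace ℝ (Fin d) → ℝ)
    (htfdiff : ∀ t m, Differentiable ℝ (tf t m))
    (htfconv : ∀ t m, ConvexOn ℝ Set.univ (tf t m))
    (htfsmooth : ∀ (t : Fin k) (m : Fin M) (u v : EuclideanSpace ℝ (Fin d)),
      ‖gradient (tf t m) u - gradient (tf t m) v‖ ≤ β * ‖u - v‖)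
    (wstar : EuclideanSpace ℝ (Fin d))
    (hfreal : ∀ m, f m wstar = 0 ∧ ∀ w, f m wstar ≤ f m w)
    (htfreal : ∀ t m, tf t m wstar = 0 ∧ ∀ w, tf t m wstar ≤ tf t m w)
    (η : Fin k → ℝ) (hηpos : ∀ t, 0 < η t)
    (hηmono : ∀ s t : Fin k, s ≤ t → η t ≤ η s)
    (ηmax : ℝ) (hηmax : ∀ t, η t ≤ ηmax) (hηβ : ηmax * β ≤ 1 / 4)
    (hsand : ∀ (t : Fin k) (m : Fin M) (w : EuclideanSpace ℝ (Fin d)),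
      tf t m w ≤ f m w ∧ f m w ≤ (1 + η t * β) * tf t m w)
    (w0 : EuclideanSpace ℝ (Fin d))
    (w : (Fin k → Fin M) → ℕ → EuclideanSpace ℝ (Fin d))
    (hw0 : ∀ τ, w τ 0 = w0)
    (hwt : ∀ (τ : Fin k → Fin M) (t : Fin k),
      w τ (t.1 + 1) = w τ t.1 - η t • gradient (tf t (τ t)) (w τ t.1)) :
    (∑ τ : Fin k → Fin M, (1 / (k : ℝ)) * ∑ t : Fin k, f (τ t) (w τ k)) / (M : ℝ) ^ k
      ≤ 2 * ((∑ τ : Fin k → Fin M, (1 / (M : ℝ)) * ∑ m, f m (w τ k)) / (M : ℝ) ^ k)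
        + 8 * β ^ 2 * ηmax * ‖w0 - wstar‖ ^ 2 / (k : ℝ) := by
  have hgf : ∀ m x, HasGradientAt (f m) (gradient (f m) x) x :=
    fun m x => (hfdiff m x).hasGradientAt
  have hgt : ∀ t m x, HasGradientAt (tf t m) (gradient (tf t m) x) x :=
    fun t m x => (htfdiff t m x).hasGradientAt
  have hf0 : ∀ m x, 0 ≤ f m x := fun m x => (hfreal m).1 ▸ (hfreal m).2 x
  have ht0 : ∀ t m x, 0 ≤ tf t m x := fun t m x => (htfreal t m).1 ▸ (htfreal t m).2 x
  have hηb : ∀ t, η t * β ≤ 1 / 4 := fun t =>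
    (mul_le_mul_of_nonneg_right (hηmax t) hβ.le).trans hηβ
  have hMpos : (0 : ℝ) < M := by exact_mod_cast hM
  have hkpos : (0 : ℝ) < k := by exact_mod_cast hk
  have hmaxpos : 0 < ηmax := (hηpos ⟨0, hk⟩).trans_le (hηmax _)
  -- pathwise regret
  have hregret : ∀ τ, ∑ t : Fin k, η t * tf t (τ t) (w τ t.1) ≤ ‖w0 - wstar‖ ^ 2 := by
    intro τ
    have h1 : ∑ t : Fin k, η t * tf t (τ t) (w τ t.1)
        ≤ ∑ t : Fin k, (‖w τ t.1 - wstar‖ ^ 2 - ‖w τ (t.1 + 1) - wstar‖ ^ 2) := by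
      refine Finset.sum_le_sum fun t _ => ?_
      rw [hwt τ t]
      exact aux_regret _ _ (hgt t (τ t)) β hβ (htfsmooth t (τ t)) (htfconv t (τ t)) (η t) (hηpos t)
        (hηb t) wstar (htfreal t (τ t)).1 (ht0 t (τ t)) _
    rw [Fin.sum_univ_eq_sum_range
      (fun i => ‖w τ i - wstar‖ ^ 2 - ‖w τ (i + 1) - wstar‖ ^ 2) k,
      Finset.sum_range_sub', hw0] at h1
    nlinarith [sq_nonneg ‖w τ k - wstar‖]
  -- iterates before step t do not depend on coordinate t
  have hpre : ∀ (τ : Fin k → Fin M) (t : Fin k) (m : Fin M) (s : ℕ), s ≤ t.1 →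
      w (Function.update τ t m) s = w τ s := by
    intro τ t m s
    induction s with
    | zero => intro _; rw [hw0, hw0]
    | succ s ih =>
      intro hs
      have hne : (⟨s, by omega⟩ : Fin k) ≠ t := by
        intro h; rw [← h] at hs; simp at hs
      have h1 := hwt (Function.update τ t m) ⟨s, by omega⟩
      have h2 := hwt τ ⟨s, by omega⟩
      simp only at h1 h2
      rw [h1, h2, ih (by omega), Function.update_of_ne hne]
  -- nonexpansiveness after step t
  have hpost : ∀ (τ : Fin k → Fin M) (t : Fin k) (m : Fin M) (s : ℕ), t.1 + 1 ≤ s → s ≤ k →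
      ‖w τ s - w (Function.update τ t m) s‖ ^ 2
        ≤ ‖w τ (t.1 + 1) - w (Function.update τ t m) (t.1 + 1)‖ ^ 2 := by
    intro τ t m s hs
    induction s, hs using Nat.le_induction with
    | base => intro _; exact le_rfl
    | succ s hs ih =>
      intro hsk
      refine le_trans ?_ (ih (by omega))
      have hne : (⟨s, by omega⟩ : Fin k) ≠ t := by
        intro h; rw [← h] at hs; simp at hs
      have h1 := hwt (Function.update τ t m) ⟨s, by omega⟩
      have h2 := hwt τ ⟨s, by omega⟩
      simp only at h1 h2
      rw [h1, h2, Function.update_of_ne hne]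
      exact aux_nonexp _ _ (hgt _ _) β hβ (htfsmooth _ _) (htfconv _ _) _ (hηpos _) (hηb _) _ _
  have hstab : ∀ (τ : Fin k → Fin M) (t : Fin k) (m : Fin M),
      ‖w τ k - w (Function.update τ t m) k‖ ^ 2 ≤ 4 * β * ηmax *
        (η t * tf t (τ t) (w τ t.1) + η t * tf t (Function.update τ t m t)
          (w (Function.update τ t m) t.1)) := by
    intro τ t m
    refine (hpost τ t m k t.2 le_rfl).trans ?_
    rw [hwt τ t, hwt (Function.update τ t m) t, hpre τ t m t.1 le_rfl, Function.update_self]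
    set x := w τ t.1
    have e : x - η t • gradient (tf t (τ t)) x - (x - η t • gradient (tf t m) x)
      = η t • (gradient (tf t m) x - gradient (tf t (τ t)) x) := by module
    rw [e, norm_smul, mul_pow, Real.norm_of_nonneg (hηpos t).le]
    have b1 := aux_selfbound _ _ (hgt t m) β hβ (htfsmooth t m) 0 (ht0 t m) x
    have b2 := aux_selfbound _ _ (hgt t (τ t)) β hβ (htfsmooth t (τ t)) 0 (ht0 t (τ t)) x
    have b3 : ‖gradient (tf t m) x - gradient (tf t (τ t)) x‖ ^ 2
        ≤ 4 * β * (tf t (τ t) x + tf t m x) := by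
      have := parallelogram_law_with_norm ℝ (gradient (tf t m) x) (gradient (tf t (τ t)) x)
      nlinarith [sq_nonneg ‖gradient (tf t m) x + gradient (tf t (τ t)) x‖]
    have b4 : 0 ≤ tf t (τ t) x + tf t m x := add_nonneg (ht0 _ _ _) (ht0 _ _ _)
    calc η t ^ 2 * ‖gradient (tf t m) x - gradient (tf t (τ t)) x‖ ^ 2
        ≤ η t ^ 2 * (4 * β * (tf t (τ t) x + tf t m x)) :=
          mul_le_mul_of_nonneg_left b3 (sq_nonneg _)
      _ = η t * (4 * β * (η t * (tf t (τ t) x + tf t m x))) := by ring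
      _ ≤ ηmax * (4 * β * (η t * (tf t (τ t) x + tf t m x))) := by
          refine mul_le_mul_of_nonneg_right (hηmax t) ?_
          have := (hηpos t).le
          positivity
      _ = _ := by ring
  set S : ℝ := ∑ τ : Fin k → Fin M, ∑ m, f m (w τ k) with hS
  have hA : ∀ t : Fin k, (M : ℝ) * ∑ τ : Fin k → Fin M, f (τ t) (w τ k)
      ≤ 2 * S + M * (8 * β ^ 2 * ηmax * ∑ τ : Fin k → Fin M, η t * tf t (τ t) (w τ t.1)) := by
    intro t
    set T : (Fin k → Fin M) → ℝ := fun τ => η t * tf t (τ t) (w τ t.1) with hT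
    have c1 : (M : ℝ) * ∑ τ : Fin k → Fin M, f (τ t) (w τ k)
        = ∑ τ : Fin k → Fin M, ∑ m : Fin M, f (τ t) (w τ k) := by
      simp [Finset.mul_sum]
    have c2 : ∑ τ : Fin k → Fin M, ∑ m : Fin M, f (τ t) (w (Function.update τ t m) k) = S := by
      rw [aux_swap t (fun σ σ' => f (σ t) (w σ' k))]
      simp [hS]
    have c3 : ∑ τ : Fin k → Fin M, ∑ m : Fin M, T τ = M * ∑ τ, T τ := by
      simp [Finset.mul_sum]
    have c4 : ∑ τ : Fin k → Fin M, ∑ m : Fin M, T (Function.update τ t m) = M * ∑ τ, T τ := by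
      rw [aux_swap t (fun _ σ' => T σ'), c3]
    rw [c1]
    calc ∑ τ : Fin k → Fin M, ∑ m : Fin M, f (τ t) (w τ k)
        ≤ ∑ τ : Fin k → Fin M, ∑ m : Fin M, (2 * f (τ t) (w (Function.update τ t m) k)
            + 4 * β ^ 2 * ηmax * (T τ + T (Function.update τ t m))) := by
          refine Finset.sum_le_sum fun τ _ => Finset.sum_le_sum fun m _ => ?_
          have a1 := aux_compare _ _ (hgf (τ t)) β hβ (hfsmooth (τ t)) (hf0 (τ t)) (w τ k)
            (w (Function.update τ t m) k)
          have a2 := mul_le_mul_of_nonneg_left (hstab τ t m) hβ.le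
          simp only [hT]
          linarith
      _ = 2 * S + 4 * β ^ 2 * ηmax * (M * ∑ τ, T τ + M * ∑ τ, T τ) := by
          simp only [Finset.sum_add_distrib, ← Finset.mul_sum]
          rw [c2, c4]
          simp [Finset.mul_sum]
      _ = _ := by ring
  have hB : (M : ℝ) * ∑ τ : Fin k → Fin M, ∑ t : Fin k, f (τ t) (w τ k)
      ≤ k * (2 * S) + M * (8 * β ^ 2 * ηmax * ((M : ℝ) ^ k * ‖w0 - wstar‖ ^ 2)) := by
    have h1 := Finset.sum_le_sum fun t (_ : t ∈ (Finset.univ : Finset (Fin k))) => hA t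
    have h3 : ∑ τ : Fin k → Fin M, ∑ t : Fin k, f (τ t) (w τ k)
        = ∑ t : Fin k, ∑ τ : Fin k → Fin M, f (τ t) (w τ k) := Finset.sum_comm
    have h4 : ∑ τ : Fin k → Fin M, ∑ t : Fin k, η t * tf t (τ t) (w τ t.1)
        = ∑ t : Fin k, ∑ τ : Fin k → Fin M, η t * tf t (τ t) (w τ t.1) := Finset.sum_comm
    rw [← Finset.mul_sum, ← h3, Finset.sum_add_distrib, Finset.sum_const, ← Finset.mul_sum,
      ← Finset.mul_sum, ← h4] at h1
    have h2 : ∑ τ : Fin k → Fin M, ∑ t : Fin k, η t * tf t (τ t) (w τ t.1)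
        ≤ (M : ℝ) ^ k * ‖w0 - wstar‖ ^ 2 := by
      refine (Finset.sum_le_sum fun τ _ => hregret τ).trans (le_of_eq ?_)
      simp
    refine h1.trans ?_
    simp only [Finset.card_univ, Fintype.card_fin, nsmul_eq_mul]
    gcongr
  rw [← Finset.mul_sum, ← Finset.mul_sum, ← hS]
  have hP : (0 : ℝ) < (M : ℝ) ^ k := by positivity
  generalize (M : ℝ) ^ k = P at *
  generalize (∑ τ : Fin k → Fin M, ∑ t : Fin k, f (τ t) (w τ k)) = A at *
  have e1 : 1 / (k : ℝ) * A / P = (M * A) / (M * k * P) := by field_simp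
  have e2 : 2 * (1 / (M : ℝ) * S / P) + 8 * β ^ 2 * ηmax * ‖w0 - wstar‖ ^ 2 / k
      = (k * (2 * S) + M * (8 * β ^ 2 * ηmax * (P * ‖w0 - wstar‖ ^ 2))) / (M * k * P) := by
    field_simp
  rw [e1, e2]
  exact div_le_div_of_nonneg_right hB (by positivity)
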